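/- Under the same hypotheses (Gaussian tail bound in direction u with strong convexity constant m, gradient Lipschitz constant M, offset b; Hamiltonian dynamics), if 0 ≤ T ≤ 1/(6√M) then for every t ∈ [0,T]: |u·q_t| ≤ |u·q₀| + t|u·p₀| + (t²/2)(−(3m/4)|u·q₀| + (m/(4√M))|u·p₀| + b + (m/(4M))b). -/

import Mathlib

open Real
open scoped InnerProductSpace

/-- Second order Taylor upper bound: if `x' = v` and `v' ≤ K` on `[a, t]`, then `v` and `x` are
bounded above by the solution with constant acceleration `K`. -/
lemma taylor_upper_of_deriv_le {x v w : ℝ → ℝ} {a t K : ℝ} (hat : a ≤ t)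
    (hx : ∀ s, HasDerivAt x (v s) s) (hv : ∀ s, HasDerivAt v (w s) s)
    (hw : ∀ s ∈ Set.Icc a t, w s ≤ K) :
    v t ≤ v a + K * (t - a) ∧ x t ≤ x a + (t - a) * v a + K * (t - a) ^ 2 / 2 := by
  have hv_le : ∀ s ∈ Set.Icc a t, v s ≤ v a + K * (s - a) := by
    have hd (s : ℝ) : HasDerivAt (fun s => v s - K * (s - a)) (w s - K * 1) s :=
      (hv s).sub (((hasDerivAt_id s).sub_const a).const_mul K)
    have hanti : AntitoneOn (fun s => v s - K * (s - a)) (Set.Icc a t) := by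
      refine antitoneOn_of_deriv_nonpos (convex_Icc a t)
        (fun s _ => (hd s).continuousAt.continuousWithinAt)
        (fun s _ => (hd s).differentiableAt.differentiableWithinAt) fun s hs => ?_
      rw [(hd s).deriv]
      linarith [hw s (interior_subset hs)]
    intro s hs
    have := hanti (Set.left_mem_Icc.2 hat) hs hs.1
    simp only [sub_self, mul_zero, sub_zero] at this
    linarith
  refine ⟨hv_le t (Set.right_mem_Icc.2 hat), ?_⟩
  have hd (s : ℝ) : HasDerivAt (fun s => x s - (s - a) * v a - K * (s - a) ^ 2 / 2)
      (v s - v a - K * (s - a)) s := by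
    have h1 := ((hasDerivAt_id s).sub_const a).mul_const (v a)
    have h2 := ((((hasDerivAt_id s).sub_const a).pow 2).const_mul K).div_const 2
    refine (((hx s).sub h1).sub h2).congr_deriv ?_
    simp
    ring
  have hanti : AntitoneOn (fun s => x s - (s - a) * v a - K * (s - a) ^ 2 / 2)
      (Set.Icc a t) := by
    refine antitoneOn_of_deriv_nonpos (convex_Icc a t)
      (fun s _ => (hd s).continuousAt.continuousWithinAt)
      (fun s _ => (hd s).differentiableAt.differentiableWithinAt) fun s hs => ?_
    rw [(hd s).deriv]
    linarith [hv_le s (interior_subset hs)]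
  have := hanti (Set.left_mem_Icc.2 hat) (Set.right_mem_Icc.2 hat) hat
  simp only [sub_self, zero_mul, sub_zero] at this
  norm_num at this
  linarith

/-- Two-sided version of `taylor_upper_of_deriv_le` on `[0, t]`. -/
lemma abs_taylor_le_of_abs_deriv_le {x v w : ℝ → ℝ} {t K : ℝ} (ht : 0 ≤ t)
    (hx : ∀ s, HasDerivAt x (v s) s) (hv : ∀ s, HasDerivAt v (w s) s)
    (hw : ∀ s ∈ Set.Icc 0 t, |w s| ≤ K) :
    |v t| ≤ |v 0| + K * t ∧ |x t - x 0| ≤ t * |v 0| + K * t ^ 2 / 2 := by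
  obtain ⟨hv₁, hx₁⟩ := taylor_upper_of_deriv_le ht hx hv fun s hs => (abs_le.1 (hw s hs)).2
  obtain ⟨hv₂, hx₂⟩ := taylor_upper_of_deriv_le (K := K) ht (fun s => (hx s).neg)
    (fun s => (hv s).neg) fun s hs => by
      have := (abs_le.1 (hw s hs)).1
      linarith
  simp only [Pi.neg_apply, sub_zero] at hv₁ hx₁ hv₂ hx₂
  have h₁ := mul_le_mul_of_nonneg_left (le_abs_self (v 0)) ht
  have h₂ := mul_le_mul_of_nonneg_left (neg_le_abs (v 0)) ht
  constructor
  · exact abs_le.2 ⟨by linarith [neg_le_abs (v 0)], by linarith [le_abs_self (v 0)]⟩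
  · exact abs_le.2 ⟨by linarith, by linarith⟩

/-- Uniform bound, over a short time interval, for the position under an acceleration of at most
linear growth. -/
lemma exists_position_bound {x v f : ℝ → ℝ} {M b r : ℝ} (hM : 0 < M) (hr : 0 ≤ r)
    (hMr : M * r ^ 2 ≤ 1 / 36)
    (hx : ∀ s, HasDerivAt x (v s) s) (hv : ∀ s, HasDerivAt v (-f s) s)
    (hf : ∀ s, |f s| ≤ M * |x s| + b) :
    ∃ Y, 0 ≤ Y ∧ 71 * Y ≤ 72 * |x 0| + 72 * (r * |v 0|) + 36 * (b * r ^ 2) ∧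
      ∀ s ∈ Set.Icc 0 r, |v s| ≤ |v 0| + (M * Y + b) * s ∧
        |x s - x 0| ≤ r * |v 0| + (M * Y + b) * r ^ 2 / 2 := by
  have hb_nonneg : ∀ s, 0 ≤ M * |x s| + b := fun s => (abs_nonneg _).trans (hf s)
  have hcont : Continuous fun s => |x s| :=
    (continuous_iff_continuousAt.2 fun s => (hx s).continuousAt).abs
  obtain ⟨σ, hσ, hmax⟩ := isCompact_Icc.exists_isMaxOn (Set.nonempty_Icc.2 hr) hcont.continuousOn
  have hY : ∀ s ∈ Set.Icc 0 r, |x s| ≤ |x σ| := fun s hs => hmax hs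
  have key : ∀ s ∈ Set.Icc 0 r, |v s| ≤ |v 0| + (M * |x σ| + b) * s ∧
      |x s - x 0| ≤ r * |v 0| + (M * |x σ| + b) * r ^ 2 / 2 := by
    intro s hs
    obtain ⟨h₁, h₂⟩ := abs_taylor_le_of_abs_deriv_le (K := M * |x σ| + b) hs.1 hx hv
      fun s' hs' => by
        rw [abs_neg]
        have := mul_le_mul_of_nonneg_left (hY s' ⟨hs'.1, hs'.2.trans hs.2⟩) hM.le
        linarith [hf s']
    refine ⟨h₁, h₂.trans ?_⟩
    have h₃ := mul_le_mul_of_nonneg_right hs.2 (abs_nonneg (v 0))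
    have h₄ := mul_le_mul_of_nonneg_left (pow_le_pow_left₀ hs.1 hs.2 2) (hb_nonneg σ)
    linarith
  refine ⟨|x σ|, abs_nonneg _, ?_, key⟩
  have h₁ := (key σ hσ).2
  have h₂ := abs_sub_abs_le_abs_sub (x σ) (x 0)
  have h₃ := mul_le_mul_of_nonneg_right hMr (abs_nonneg (x σ))
  linarith

/-- One-dimensional upper bound for the position, the force being pulled towards the origin at
rate at least `m` up to an offset `b`. -/
lemma position_le_of_restoring_force {x v f : ℝ → ℝ} {m M b t : ℝ} (hm : 0 < m) (hmM : m ≤ M)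
    (hb : 0 ≤ b) (ht : 0 ≤ t) (htM : t * √M ≤ 1 / 6)
    (hx : ∀ s, HasDerivAt x (v s) s) (hv : ∀ s, HasDerivAt v (-f s) s)
    (hf : ∀ s, |f s| ≤ M * |x s| + b) (hf_low : ∀ s, 0 ≤ x s → m * x s - b ≤ f s) :
    x t ≤ |x 0| + t * |v 0|
        + (t ^ 2 / 2) * (-(3 * m / 4) * |x 0| + (m / (4 * √M)) * |v 0| + b + (m / (4 * M)) * b) := by
  have hM : 0 < M := hm.trans_le hmM
  have hsqrt : 0 < √M := Real.sqrt_pos.2 hM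
  have hMt : M * t ^ 2 ≤ 1 / 36 := by
    have := pow_le_pow_left₀ (mul_nonneg ht hsqrt.le) htM 2
    rw [mul_pow, Real.sq_sqrt hM.le] at this
    linarith
  have hmt : m * t ^ 2 ≤ 1 / 36 :=
    (mul_le_mul_of_nonneg_right hmM (sq_nonneg t)).trans hMt
  have hx₀ := abs_nonneg (x 0)
  have hv₀ := abs_nonneg (v 0)
  have hweak : (1 - 3 / 288) * |x 0| + t * |v 0| + b * t ^ 2 / 2 ≤ |x 0| + t * |v 0|
      + (t ^ 2 / 2) * (-(3 * m / 4) * |x 0| + (m / (4 * √M)) * |v 0| + b + (m / (4 * M)) * b) := by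
    have h₁ := mul_le_mul_of_nonneg_right hmt hx₀
    have h₂ : 0 ≤ t ^ 2 / 2 * (m / (4 * √M) * |v 0| + m / (4 * M) * b) := by positivity
    linarith
  have hcont : Continuous x := continuous_iff_continuousAt.2 fun s => (hx s).continuousAt
  rcases le_or_gt (x t) 0 with hxt | hxt
  · exact (hxt.trans (by norm_num; positivity)).trans hweak
  have hpos : ∀ s ≤ t, (∀ r ∈ Set.Icc s t, x r ≠ 0) → 0 < x s := by
    intro s hs hne
    by_contra! hxs
    obtain ⟨r, hr, hr₀⟩ := intermediate_value_Icc hs hcont.continuousOn ⟨hxs, hxt.le⟩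
    exact hne r hr hr₀
  by_cases hzero : ∃ s ∈ Set.Icc 0 t, x s = 0
  · refine le_trans ?_ hweak
    obtain ⟨τ, ⟨hτ, hxτ⟩, hlast⟩ :=
      (isCompact_Icc.inter_right (isClosed_singleton.preimage hcont)).exists_isGreatest
        (s := Set.Icc 0 t ∩ x ⁻¹' {0}) (by
          obtain ⟨s, hs, hs₀⟩ := hzero
          exact ⟨s, hs, hs₀⟩)
    replace hxτ : x τ = 0 := hxτ
    have hnonneg : ∀ s ∈ Set.Icc τ t, 0 ≤ x s := by
      intro s hs
      rcases hs.1.eq_or_lt with rfl | hlt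
      · exact hxτ.ge
      · refine (hpos s hs.2 fun r hr hr₀ => ?_).le
        exact absurd (hlast ⟨⟨hτ.1.trans (hs.1.trans hr.1), hr.2⟩, hr₀⟩)
          (not_le.2 (hlt.trans_le hr.1))
    have hend := (taylor_upper_of_deriv_le (K := b) hτ.2 hx hv fun s hs => by
      have := mul_nonneg hm.le (hnonneg s hs)
      linarith [hf_low s (hnonneg s hs)]).2
    have hMτ : M * τ ^ 2 ≤ 1 / 36 :=
      (mul_le_mul_of_nonneg_left (pow_le_pow_left₀ hτ.1 hτ.2 2) hM.le).trans hMt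
    obtain ⟨Y, hY₀, hY, hbound⟩ := exists_position_bound hM hτ.1 hMτ hx hv hf
    have hvτ := (le_abs_self _).trans (hbound τ (Set.right_mem_Icc.2 hτ.1)).1
    have h₁ := mul_le_mul_of_nonneg_left hvτ (sub_nonneg.2 hτ.2)
    have h₂ : M * ((t - τ) * τ) ≤ 1 / 144 := by
      have := mul_nonneg hM.le (sq_nonneg (t - 2 * τ))
      linarith
    have h₃ := mul_le_mul_of_nonneg_right h₂ hY₀
    have h₄ := mul_nonneg hτ.1 hv₀
    have h₅ := mul_nonneg hb (sq_nonneg τ)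
    rw [hxτ] at hend
    linarith
  · push Not at hzero
    have hx_pos : ∀ s ∈ Set.Icc 0 t, 0 < x s := fun s hs =>
      hpos s hs.2 fun r hr => hzero r ⟨hs.1.trans hr.1, hr.2⟩
    obtain ⟨Y, hY₀, hY, hbound⟩ := exists_position_bound hM ht hMt hx hv hf
    have hlower : ∀ s ∈ Set.Icc 0 t,
        3 / 4 * |x 0| - 1 / (4 * √M) * |v 0| - 1 / (4 * M) * b ≤ x s := by
      intro s hs
      have h₁ := (abs_le.1 (hbound s hs).2).1
      have h₂ : t * |v 0| ≤ 1 / (6 * √M) * |v 0| := by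
        refine mul_le_mul_of_nonneg_right ?_ hv₀
        rw [le_div_iff₀ (by positivity)]
        linarith
      have h₃ : t ^ 2 * b ≤ 1 / (36 * M) * b := by
        refine mul_le_mul_of_nonneg_right ?_ hb
        rw [le_div_iff₀ (by positivity)]
        linarith
      have h₄ := mul_le_mul_of_nonneg_right hMt hY₀
      have h₅ : 1 / (4 * √M) * |v 0| = 3 / 2 * (1 / (6 * √M) * |v 0|) := by field_simp; ring
      have h₆ : 1 / (4 * M) * b = 9 * (1 / (36 * M) * b) := by field_simp; ring
      have h₇ : 0 ≤ 1 / (6 * √M) * |v 0| := by positivity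
      have h₈ : 0 ≤ 1 / (36 * M) * b := by positivity
      rw [h₅, h₆]
      rw [abs_of_pos (hx_pos 0 (Set.left_mem_Icc.2 ht))] at hY ⊢
      linarith [hx_pos 0 (Set.left_mem_Icc.2 ht)]
    have hend := (taylor_upper_of_deriv_le
      (K := b - m * (3 / 4 * |x 0| - 1 / (4 * √M) * |v 0| - 1 / (4 * M) * b)) ht hx hv
      fun s hs => by
        have := mul_le_mul_of_nonneg_left (hlower s hs) hm.le
        linarith [hf_low s (hx_pos s hs).le]).2
    have h₁ := mul_le_mul_of_nonneg_left (le_abs_self (v 0)) ht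
    rw [sub_zero] at hend
    have h₂ : m / (4 * √M) = m * (1 / (4 * √M)) := by ring
    have h₃ : m / (4 * M) = m * (1 / (4 * M)) := by ring
    rw [h₂, h₃]
    linarith [le_abs_self (x 0)]

/-- refined upper bound on the component of the position in direction `u`
over a short time interval, under the two-sided Gaussian tail bound. -/
theorem hmc_projected_position_refined_upper_bound {d : ℕ}
    (U : EuclideanSpace ℝ (Fin d) → ℝ)
    (gU : EuclideanSpace ℝ (Fin d) → EuclideanSpace ℝ (Fin d))
    (hU : ∀ x, HasGradientAt U (gU x) x)
    (u : EuclideanSpace ℝ (Fin d)) (hu : ‖u‖ = 1)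
    (m M b : ℝ) (hm : 0 < m) (hmM : m ≤ M) (hb : 0 ≤ b)
    (htail : ∀ x, min (m * ⟪u, x⟫_ℝ) (M * ⟪u, x⟫_ℝ) - b ≤ ⟪u, gU x⟫_ℝ ∧
      ⟪u, gU x⟫_ℝ ≤ max (m * ⟪u, x⟫_ℝ) (M * ⟪u, x⟫_ℝ) + b)
    (q p : ℝ → EuclideanSpace ℝ (Fin d))
    (hq : ∀ t, HasDerivAt q (p t) t)
    (hp : ∀ t, HasDerivAt p (-gU (q t)) t)
    (T : ℝ) (hT0 : 0 ≤ T) (hT : T ≤ 1 / (6 * Real.sqrt M)) :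
    ∀ t ∈ Set.Icc (0:ℝ) T,
      |⟪u, q t⟫_ℝ| ≤ |⟪u, q 0⟫_ℝ| + t * |⟪u, p 0⟫_ℝ|
        + (t^2 / 2) * (-(3 * m / 4) * |⟪u, q 0⟫_ℝ|
            + (m / (4 * Real.sqrt M)) * |⟪u, p 0⟫_ℝ| + b + (m / (4 * M)) * b) := by
  intro t ht
  have hM : 0 < M := hm.trans_le hmM
  have htM : t * √M ≤ 1 / 6 := by
    have := ht.2.trans hT
    rw [le_div_iff₀ (by positivity)] at this
    linarith
  have hx (s : ℝ) : HasDerivAt (fun s => ⟪u, q s⟫_ℝ) ⟪u, p s⟫_ℝ s :=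
    (innerSL ℝ u).hasFDerivAt.comp_hasDerivAt s (hq s)
  have hv (s : ℝ) : HasDerivAt (fun s => ⟪u, p s⟫_ℝ) (-⟪u, gU (q s)⟫_ℝ) s :=
    ((innerSL ℝ u).hasFDerivAt.comp_hasDerivAt s (hp s)).congr_deriv (by simp)
  have hlow (s : ℝ) (hs : 0 ≤ ⟪u, q s⟫_ℝ) :
      m * ⟪u, q s⟫_ℝ - b ≤ ⟪u, gU (q s)⟫_ℝ ∧ ⟪u, gU (q s)⟫_ℝ ≤ M * ⟪u, q s⟫_ℝ + b := by
    have hle := mul_le_mul_of_nonneg_right hmM hs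
    have := htail (q s)
    rwa [min_eq_left hle, max_eq_right hle] at this
  have hup (s : ℝ) (hs : ⟪u, q s⟫_ℝ ≤ 0) :
      M * ⟪u, q s⟫_ℝ - b ≤ ⟪u, gU (q s)⟫_ℝ ∧ ⟪u, gU (q s)⟫_ℝ ≤ m * ⟪u, q s⟫_ℝ + b := by
    have hle := mul_le_mul_of_nonpos_right hmM hs
    have := htail (q s)
    rwa [min_eq_right hle, max_eq_left hle] at this
  have hf (s : ℝ) : |⟪u, gU (q s)⟫_ℝ| ≤ M * |⟪u, q s⟫_ℝ| + b := by
    rcases le_total 0 ⟪u, q s⟫_ℝ with hs | hs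
    · have := mul_nonneg hm.le hs
      have := mul_nonneg hM.le hs
      rw [abs_of_nonneg hs]
      exact abs_le.2 ⟨by linarith [hlow s hs], by linarith [hlow s hs]⟩
    · have := mul_nonpos_of_nonneg_of_nonpos hm.le hs
      have := mul_nonpos_of_nonneg_of_nonpos hM.le hs
      rw [abs_of_nonpos hs]
      exact abs_le.2 ⟨by linarith [hup s hs], by linarith [hup s hs]⟩
  refine abs_le'.2 ⟨?_, ?_⟩
  · exact position_le_of_restoring_force hm hmM hb ht.1 htM hx hv hf fun s hs => (hlow s hs).1
  · have := position_le_of_restoring_force (x := fun s => -⟪u, q s⟫_ℝ)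
      (v := fun s => -⟪u, p s⟫_ℝ) (f := fun s => -⟪u, gU (q s)⟫_ℝ) hm hmM hb ht.1 htM
      (fun s => (hx s).neg) (fun s => (hv s).neg) (fun s => by simpa only [abs_neg] using hf s)
      (fun s hs => by linarith [(hup s (by linarith)).2])
    simpa only [abs_neg] using this
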